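/- Every integer is realised as the rotation number of a Legendrian immersed loop in (ℝ³, ξ): for every n ∈ ℤ there exists a Legendrian immersed loop γ̄ : ℝ → ℝ³ with rot(γ̄) = n. Consequently, the map γ̄ ↦ rot(γ̄) induces a one-to-one correspondence between Legendrian regular homotopy classes of Legendrian immersed loops in (ℝ³, ξ) and ℤ. -/

import Mathlib

/-- A Legendrian immersed loop in `(ℝ³, ξ)`, `ξ = ker(dz - y dx)`: a smooth
1-periodic curve `γ̄ = (x,y,z)` with nowhere-vanishing derivative satisfying
`z' = y·x'`. -/
structure IsLegendrianLoop (γ : ℝ → ℝ × ℝ × ℝ) : Prop where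
  smooth : ContDiff ℝ (⊤ : ℕ∞) γ
  periodic : Function.Periodic γ 1
  immersed : ∀ s : ℝ, deriv γ s ≠ 0
  tangent : ∀ s : ℝ, deriv (fun t => (γ t).2.2) s
      = (γ s).2.1 * deriv (fun t => (γ t).1) s

/-- `rot(γ̄) = n`: the winding number of `s ↦ (x'(s), y'(s))` around the origin
over one period equals `n`, expressed via a continuous angle function `θ`. -/
def HasLegRotationNumber (γ : ℝ → ℝ × ℝ × ℝ) (n : ℤ) : Prop :=
  ∃ θ : ℝ → ℝ, Continuous θ ∧
    (∀ s : ℝ,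
      deriv (fun t => (γ t).1) s
        = Real.sqrt ((deriv (fun t => (γ t).1) s) ^ 2
            + (deriv (fun t => (γ t).2.1) s) ^ 2) * Real.cos (θ s) ∧
      deriv (fun t => (γ t).2.1) s
        = Real.sqrt ((deriv (fun t => (γ t).1) s) ^ 2
            + (deriv (fun t => (γ t).2.1) s) ^ 2) * Real.sin (θ s)) ∧
    θ 1 - θ 0 = 2 * Real.pi * (n : ℝ)

/-- A Legendrian regular homotopy: a smooth map `H : [0,1] × ℝ → ℝ³` such that
each `H t` (for `t ∈ [0,1]`) is a Legendrian immersed loop. -/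
def IsLegendrianRegularHomotopy (H : ℝ → ℝ → ℝ × ℝ × ℝ) : Prop :=
  ContDiffOn ℝ (⊤ : ℕ∞) (Function.uncurry H) (Set.Icc (0:ℝ) 1 ×ˢ (Set.univ : Set ℝ)) ∧
  ∀ t ∈ Set.Icc (0:ℝ) 1, IsLegendrianLoop (H t)

open MeasureTheory
open scoped ContDiff

/-! ### Smoothness of parametric integrals -/

theorem contDiff_integral_zero_one {P : Type*} [NormedAddCommGroup P] [NormedSpace ℝ P]
    {f : P → ℝ → ℝ} (hf : ContDiff ℝ ∞ (Function.uncurry f)) :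
    ContDiff ℝ ∞ (fun p => ∫ σ in (0:ℝ)..1, f p σ) := by
  let χ : ContDiffBump (0 : ℝ) := ⟨1, 2, one_pos, one_lt_two⟩
  let φ : ℝ → ℝ := (Set.Ioc (0:ℝ) 1).indicator (fun _ => 1)
  let g : P → ℝ → ℝ := fun p x => χ x * f p (-x)
  have hφ : LocallyIntegrable φ volume :=
    ((integrable_indicator_iff measurableSet_Ioc).2
      (by simp : IntegrableOn (fun _ => (1:ℝ)) (Set.Ioc (0:ℝ) 1) volume)).locallyIntegrable
  have hg : ContDiff ℝ ∞ (Function.uncurry g) :=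
    (χ.contDiff.comp contDiff_snd).mul
      (hf.comp (contDiff_fst.prodMk contDiff_snd.neg))
  have key := contDiffOn_convolution_right_with_param (μ := volume) (n := ⊤)
    (ContinuousLinearMap.mul ℝ ℝ) (f := φ) (g := g) (s := Set.univ)
    isOpen_univ (isCompact_closedBall (0:ℝ) 2)
    (fun p x _ hx => by
      have : χ x = 0 := χ.zero_of_le_dist (by
        simpa [χ] using (not_le.1 (fun h => hx (by simpa using h) : ¬ |x| ≤ 2)).le)
      simp [g, this]) hφ hg.contDiffOn
  rw [Set.univ_prod_univ, contDiffOn_univ] at key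
  have h0 : ContDiff ℝ ∞ (fun p : P => (p, (0:ℝ))) := contDiff_id.prodMk contDiff_const
  convert key.comp h0 using 1
  ext p
  simp only [Function.comp_apply, convolution, ContinuousLinearMap.mul_apply', φ, g]
  rw [intervalIntegral.integral_of_le zero_le_one, ← integral_indicator measurableSet_Ioc]
  congr 1
  ext t
  by_cases ht : t ∈ Set.Ioc (0:ℝ) 1
  · have : χ (0 - t) = 1 := χ.one_of_mem_closedBall (by
      simp only [zero_sub, Metric.mem_closedBall, dist_zero_right, norm_neg, Real.norm_eq_abs, χ]
      rw [abs_of_pos ht.1]; exact ht.2)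
    rw [Set.indicator_of_mem ht, Set.indicator_of_mem ht, this]
    simp
  · simp [Set.indicator_of_notMem ht]

theorem contDiff_primitive {P : Type*} [NormedAddCommGroup P] [NormedSpace ℝ P]
    {f : P → ℝ → ℝ} (hf : ContDiff ℝ ∞ (Function.uncurry f)) :
    ContDiff ℝ ∞ (Function.uncurry fun p s => ∫ σ in (0:ℝ)..s, f p σ) := by
  have h : (Function.uncurry fun p s => ∫ σ in (0:ℝ)..s, f p σ)
      = fun q : P × ℝ => q.2 * ∫ σ in (0:ℝ)..1, f q.1 (q.2 * σ) := by
    ext ⟨p, s⟩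
    simp
  rw [h]
  refine contDiff_snd.mul (contDiff_integral_zero_one
    (f := fun q : P × ℝ => fun σ => f q.1 (q.2 * σ)) ?_)
  exact hf.comp ((contDiff_fst.comp contDiff_fst).prodMk
    ((contDiff_snd.comp contDiff_fst).mul contDiff_snd))

/-! ### Periodic functions -/

theorem Function.Periodic.integral_pos {g : ℝ → ℝ} (hg : Continuous g)
    (hper : Function.Periodic g 1) (h0 : ∀ s, 0 ≤ g s) {p : ℝ} (hp : g p ≠ 0) :
    0 < ∫ s in (0:ℝ)..1, g s := by
  have h := hper.intervalIntegral_add_eq 0 p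
  rw [zero_add] at h
  rw [h]
  exact intervalIntegral.integral_pos (by linarith) hg.continuousOn (fun s _ => h0 s)
    ⟨p, by constructor <;> linarith, lt_of_le_of_ne (h0 p) hp.symm⟩

theorem Function.Periodic.primitive {g : ℝ → ℝ} (hg : Continuous g)
    (hper : Function.Periodic g 1) (h0 : ∫ s in (0:ℝ)..1, g s = 0) (c : ℝ) :
    Function.Periodic (fun s => c + ∫ σ in (0:ℝ)..s, g σ) 1 := by
  intro s
  have h := hper.intervalIntegral_add_eq 0 s
  rw [zero_add, h0] at h
  simp only
  rw [← intervalIntegral.integral_add_adjacent_intervals (hg.intervalIntegrable 0 s)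
    (hg.intervalIntegrable s (s + 1)), ← h, add_zero]

theorem hasDerivAt_primitive {g : ℝ → ℝ} (hg : Continuous g) (c s : ℝ) :
    HasDerivAt (fun s => c + ∫ σ in (0:ℝ)..s, g σ) (g s) s :=
  (intervalIntegral.integral_hasDerivAt_right (hg.intervalIntegrable 0 s)
    hg.aestronglyMeasurable.stronglyMeasurableAtFilter hg.continuousAt).const_add c

/-! ### Angle functions of planar vector fields -/

/-- `θ` is an angle function of the planar vector field `(u, w)`. -/
def IsAngle {X : Type*} (u w θ : X → ℝ) : Prop :=
  ∀ s, u s = Real.sqrt (u s ^ 2 + w s ^ 2) * Real.cos (θ s) ∧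
    w s = Real.sqrt (u s ^ 2 + w s ^ 2) * Real.sin (θ s)

theorem isAngle_polar {X : Type*} {ρ : X → ℝ} (hρ : ∀ s, 0 < ρ s) (θ : X → ℝ) :
    IsAngle (fun s => ρ s * Real.cos (θ s)) (fun s => ρ s * Real.sin (θ s)) θ := by
  intro s
  have : Real.sqrt ((ρ s * Real.cos (θ s)) ^ 2 + (ρ s * Real.sin (θ s)) ^ 2) = ρ s := by
    rw [show (ρ s * Real.cos (θ s)) ^ 2 + (ρ s * Real.sin (θ s)) ^ 2 = ρ s ^ 2 by
      linear_combination (ρ s) ^ 2 * Real.sin_sq_add_cos_sq (θ s)]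
    exact Real.sqrt_sq (hρ s).le
  simp only [this, and_self]

theorem speed_pos {a b : ℝ} (h : a ≠ 0 ∨ b ≠ 0) : 0 < Real.sqrt (a ^ 2 + b ^ 2) := by
  apply Real.sqrt_pos.2
  rcases h with h | h <;> positivity

theorem exists_int_of_polar_eq {r a b : ℝ} (hr : 0 < r)
    (hc : r * Real.cos a = r * Real.cos b) (hs : r * Real.sin a = r * Real.sin b) :
    ∃ k : ℤ, a - b = 2 * Real.pi * k :=
  Real.Angle.angle_eq_iff_two_pi_dvd_sub.1
    (Real.Angle.cos_sin_inj (mul_left_cancel₀ hr.ne' hc) (mul_left_cancel₀ hr.ne' hs))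

theorem eq_of_forall_mem_two_pi_mul_int {g : ℝ → ℝ} (hg : Continuous g)
    (h : ∀ s, ∃ k : ℤ, g s = 2 * Real.pi * k) (a b : ℝ) : g a = g b := by
  choose k hk using h
  have hcont : Continuous fun s => ((k s : ℤ) : ℝ) := by
    have : (fun s => ((k s : ℤ) : ℝ)) = fun s => g s / (2 * Real.pi) := by
      ext s
      rw [hk s]
      field_simp
    rw [this]
    fun_prop
  have hk' : Continuous k := Int.isClosedEmbedding_coe_real.isInducing.continuous_iff.2 hcont
  rw [hk a, hk b, PreconnectedSpace.constant inferInstance hk' (x := a) (y := b)]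

theorem IsAngle.sub_eq {u w θ θ' : ℝ → ℝ} (hne : ∀ s, u s ≠ 0 ∨ w s ≠ 0)
    (hθ : Continuous θ) (hθ' : Continuous θ') (h : IsAngle u w θ) (h' : IsAngle u w θ')
    (a b : ℝ) : θ b - θ a = θ' b - θ' a := by
  have := eq_of_forall_mem_two_pi_mul_int (hθ.sub hθ') (fun s =>
    exists_int_of_polar_eq (speed_pos (hne s)) ((h s).1.symm.trans (h' s).1)
      ((h s).2.symm.trans (h' s).2)) a b
  simp only [Pi.sub_apply] at this
  linarith

theorem exists_isAngle {U W : ℝ × ℝ → ℝ} (hU : Continuous U) (hW : Continuous W)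
    (hne : ∀ p, U p ≠ 0 ∨ W p ≠ 0) : ∃ Θ : ℝ × ℝ → ℝ, Continuous Θ ∧ IsAngle U W Θ := by
  let V : ℝ × ℝ → ℂ := fun p => ⟨U p, W p⟩
  have hV : Continuous V := by
    have : V = fun p => (U p : ℂ) + (W p : ℂ) * Complex.I := by
      ext p
      exact Complex.mk_eq_add_mul_I _ _
    rw [this]
    fun_prop
  have hV0 : (0:ℂ) ∉ V '' Set.univ := by
    rintro ⟨p, -, hp⟩
    have h1 : U p = 0 := congrArg Complex.re hp
    have h2 : W p = 0 := congrArg Complex.im hp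
    rcases hne p with h | h <;> contradiction
  have : ContractibleSpace (Set.univ : Set (ℝ × ℝ)) :=
    convex_univ.contractibleSpace Set.univ_nonempty
  obtain ⟨L, hL, hexp⟩ := Complex.exists_continuousOn_eqOn_exp_comp
    (SimplyConnectedSpace.ofContractible (Set.univ : Set (ℝ × ℝ))) isOpen_univ hV.continuousOn hV0
  rw [continuousOn_univ] at hL
  refine ⟨fun p => (L p).im, Complex.continuous_im.comp hL, ?_⟩
  have hre : ∀ p, U p = Real.exp (L p).re * Real.cos (L p).im := fun p => by
    rw [← Complex.exp_re]; exact (congrArg Complex.re (hexp (Set.mem_univ p))).symm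
  have him : ∀ p, W p = Real.exp (L p).re * Real.sin (L p).im := fun p => by
    rw [← Complex.exp_im]; exact (congrArg Complex.im (hexp (Set.mem_univ p))).symm
  have := isAngle_polar (fun p => Real.exp_pos (L p).re) (fun p => (L p).im)
  rw [← funext hre, ← funext him] at this
  exact this

/-- The winding number of a periodic planar vector field is invariant under homotopies through
nowhere-vanishing periodic fields. -/
theorem IsAngle.exists_of_homotopy {U W : ℝ × ℝ → ℝ} (hU : Continuous U) (hW : Continuous W)
    (hne : ∀ p, U p ≠ 0 ∨ W p ≠ 0) (hUp : ∀ t, U (t, 1) = U (t, 0))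
    (hWp : ∀ t, W (t, 1) = W (t, 0)) {θ : ℝ → ℝ} (hθ : Continuous θ)
    (h : IsAngle (fun s => U (0, s)) (fun s => W (0, s)) θ) :
    ∃ θ' : ℝ → ℝ, Continuous θ' ∧ IsAngle (fun s => U (1, s)) (fun s => W (1, s)) θ' ∧
      θ' 1 - θ' 0 = θ 1 - θ 0 := by
  obtain ⟨Θ, hΘ, hang⟩ := exists_isAngle hU hW hne
  refine ⟨fun s => Θ (1, s), by fun_prop, fun s => hang (1, s), ?_⟩
  rw [h.sub_eq (fun s => hne (0, s)) hθ (by fun_prop : Continuous fun s => Θ (0, s))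
    (fun s => hang (0, s)) 0 1]
  refine eq_of_forall_mem_two_pi_mul_int (g := fun t => Θ (t, 1) - Θ (t, 0)) (by fun_prop)
    (fun t => exists_int_of_polar_eq (speed_pos (hne (t, 0))) ?_ ?_) 1 0
  · rw [← (hang (t, 0)).1, ← hUp t, ← hWp t, ← (hang (t, 1)).1]
  · rw [← (hang (t, 0)).2, ← hUp t, ← hWp t, ← (hang (t, 1)).2]

theorem IsAngle.contDiff {u w θ : ℝ → ℝ} (hu : ContDiff ℝ ∞ u) (hw : ContDiff ℝ ∞ w)
    (hne : ∀ s, u s ≠ 0 ∨ w s ≠ 0) (hθ : Continuous θ) (h : IsAngle u w θ) :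
    ContDiff ℝ ∞ θ := by
  have hr : ContDiff ℝ ∞ fun s => Real.sqrt (u s ^ 2 + w s ^ 2) :=
    ((hu.pow 2).add (hw.pow 2)).sqrt fun s => (Real.sqrt_pos.1 (speed_pos (hne s))).ne'
  have hcos : ContDiff ℝ ∞ fun s => Real.cos (θ s) := by
    have heq : (fun s => Real.cos (θ s)) = u / fun s => Real.sqrt (u s ^ 2 + w s ^ 2) :=
      funext fun s => eq_div_of_mul_eq (speed_pos (hne s)).ne' ((mul_comm _ _).trans (h s).1.symm)
    exact heq ▸ hu.div hr fun s => (speed_pos (hne s)).ne'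
  have hsin : ContDiff ℝ ∞ fun s => Real.sin (θ s) := by
    have heq : (fun s => Real.sin (θ s)) = w / fun s => Real.sqrt (u s ^ 2 + w s ^ 2) :=
      funext fun s => eq_div_of_mul_eq (speed_pos (hne s)).ne' ((mul_comm _ _).trans (h s).2.symm)
    exact heq ▸ hw.div hr fun s => (speed_pos (hne s)).ne'
  rw [contDiff_iff_contDiffAt]
  intro a
  have hloc : ContDiffAt ℝ ∞ (fun s => θ a + Real.arcsin (Real.sin (θ s - θ a))) a := by
    refine contDiffAt_const.add (ContDiffAt.comp (g := Real.arcsin) a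
      (Real.contDiffAt_arcsin ?_ ?_) ?_)
    · simp
    · simp
    · simp only [Real.sin_sub]
      exact ((hsin.mul contDiff_const).sub (hcos.mul contDiff_const)).contDiffAt
  refine hloc.congr_of_eventuallyEq ?_
  have hnear : ∀ᶠ s in nhds a, |θ s - θ a| < Real.pi / 2 := by
    have : Continuous fun s => |θ s - θ a| := by fun_prop
    exact this.continuousAt.eventually_lt_const (by simpa using Real.pi_div_two_pos)
  filter_upwards [hnear] with s hs
  rw [abs_lt] at hs
  rw [Real.arcsin_sin (by linarith) (by linarith)]
  ring

/-! ### Legendrian loops with prescribed direction data -/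

/-- The vertical speed `ρ sin f`, corrected by a multiple of `cos² f` to have zero mean. -/
noncomputable def ordinateSpeed (f ρ : ℝ → ℝ) (s : ℝ) : ℝ :=
  ρ s * Real.sin (f s) - (∫ σ in (0:ℝ)..1, ρ σ * Real.sin (f σ)) /
    (∫ σ in (0:ℝ)..1, Real.cos (f σ) ^ 2) * Real.cos (f s) ^ 2

/-- The mean of `y` with respect to the weight `w²`. -/
noncomputable def weightedMean (w y : ℝ → ℝ) : ℝ :=
  (∫ σ in (0:ℝ)..1, y σ * w σ ^ 2) / ∫ σ in (0:ℝ)..1, w σ ^ 2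

/-- The function `g`, corrected by multiples of `w²` and `y w²` to be orthogonal to `1` and `y`. -/
noncomputable def orthogonalized (g w y : ℝ → ℝ) (s : ℝ) : ℝ :=
  g s - (∫ σ in (0:ℝ)..1, g σ) / (∫ σ in (0:ℝ)..1, w σ ^ 2) * w s ^ 2
    - (∫ σ in (0:ℝ)..1, (y σ - weightedMean w y) * g σ) /
      (∫ σ in (0:ℝ)..1, ((y σ - weightedMean w y) * w σ) ^ 2) *
        ((y s - weightedMean w y) * w s ^ 2)

/-- The `y`-coordinate of the loop `legLoop f ρ x₀ y₀ z₀`. -/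
noncomputable def ordinate (f ρ : ℝ → ℝ) (y₀ s : ℝ) : ℝ :=
  y₀ + ∫ σ in (0:ℝ)..s, ordinateSpeed f ρ σ

/-- The derivative of the `x`-coordinate of the loop `legLoop f ρ x₀ y₀ z₀`. -/
noncomputable def abscissaSpeed (f ρ : ℝ → ℝ) (y₀ : ℝ) : ℝ → ℝ :=
  orthogonalized (fun s => ρ s * Real.cos (f s)) (ordinateSpeed f ρ) (ordinate f ρ y₀)

/-- A Legendrian loop whose Lagrangian projection has velocity homotopic to `ρ (cos f, sin f)`. -/
noncomputable def legLoop (f ρ : ℝ → ℝ) (x₀ y₀ z₀ s : ℝ) : ℝ × ℝ × ℝ :=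
  (x₀ + ∫ σ in (0:ℝ)..s, abscissaSpeed f ρ y₀ σ, ordinate f ρ y₀ s,
    z₀ + ∫ σ in (0:ℝ)..s, ordinate f ρ y₀ σ * abscissaSpeed f ρ y₀ σ)

/-- Direction data of winding number `n` from which a Legendrian loop can be built: an angle `f`
which crosses a zero of the cosine, and a speed `ρ`. -/
structure IsDirectionDatum (n : ℤ) (f ρ : ℝ → ℝ) : Prop where
  contDiff_angle : ContDiff ℝ ∞ f
  contDiff_speed : ContDiff ℝ ∞ ρ
  angle_add_one : ∀ s, f (s + 1) = f s + 2 * Real.pi * n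
  periodic_speed : Function.Periodic ρ 1
  speed_pos : ∀ s, 0 < ρ s
  crossing : ∃ p q c, f p < c ∧ c < f q ∧ Real.cos c = 0

theorem integral_orthogonalized {g w y : ℝ → ℝ} (hg : Continuous g) (hw : Continuous w)
    (hy : Continuous y) (hA : ∫ σ in (0:ℝ)..1, w σ ^ 2 ≠ 0)
    (hC : ∫ σ in (0:ℝ)..1, ((y σ - weightedMean w y) * w σ) ^ 2 ≠ 0) :
    (∫ s in (0:ℝ)..1, orthogonalized g w y s = 0) ∧
      ∫ s in (0:ℝ)..1, y s * orthogonalized g w y s = 0 := by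
  set b := weightedMean w y with hb
  set e₁ := (∫ σ in (0:ℝ)..1, g σ) / (∫ σ in (0:ℝ)..1, w σ ^ 2) with he₁
  set e₂ := (∫ σ in (0:ℝ)..1, (y σ - b) * g σ) /
      (∫ σ in (0:ℝ)..1, ((y σ - b) * w σ) ^ 2) with he₂
  have hI : ∀ {h : ℝ → ℝ}, Continuous h → IntervalIntegrable h volume 0 1 :=
    fun h => h.intervalIntegrable 0 1
  have hmean : ∫ s in (0:ℝ)..1, (y s - b) * w s ^ 2 = 0 := by
    simp only [sub_mul]
    rw [intervalIntegral.integral_sub (hI (by fun_prop)) (hI (by fun_prop)),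
      intervalIntegral.integral_const_mul, hb, weightedMean, div_mul_cancel₀ _ hA, sub_self]
  have h0 : ∫ s in (0:ℝ)..1, orthogonalized g w y s = 0 := by
    simp only [orthogonalized, ← hb, ← he₁, ← he₂]
    rw [intervalIntegral.integral_sub (hI (by fun_prop)) (hI (by fun_prop)),
      intervalIntegral.integral_sub (hI (by fun_prop)) (hI (by fun_prop)),
      intervalIntegral.integral_const_mul, intervalIntegral.integral_const_mul, hmean, he₁,
      div_mul_cancel₀ _ hA]
    ring
  have h1 : ∫ s in (0:ℝ)..1, (y s - b) * orthogonalized g w y s = 0 := by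
    have : ∀ s, (y s - b) * orthogonalized g w y s
        = (y s - b) * g s - e₁ * ((y s - b) * w s ^ 2) - e₂ * ((y s - b) * w s) ^ 2 := by
      intro s
      simp only [orthogonalized, ← hb, ← he₁, ← he₂]
      ring
    simp only [this]
    rw [intervalIntegral.integral_sub (hI (by fun_prop)) (hI (by fun_prop)),
      intervalIntegral.integral_sub (hI (by fun_prop)) (hI (by fun_prop)),
      intervalIntegral.integral_const_mul, intervalIntegral.integral_const_mul, hmean, he₂,
      div_mul_cancel₀ _ hC]
    ring
  have hcont : Continuous (orthogonalized g w y) := by unfold orthogonalized; fun_prop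
  refine ⟨h0, ?_⟩
  have : ∀ s, y s * orthogonalized g w y s
      = (y s - b) * orthogonalized g w y s + b * orthogonalized g w y s := fun s => by ring
  simp only [this]
  rw [intervalIntegral.integral_add (hI (by fun_prop)) (hI (by fun_prop)), h1,
    intervalIntegral.integral_const_mul, h0]
  ring

theorem sin_ne_zero_of_cos_eq_zero {x : ℝ} (hx : Real.cos x = 0) : Real.sin x ≠ 0 := fun h => by
  simpa [h, hx] using Real.sin_sq_add_cos_sq x

namespace IsDirectionDatum

theorem exists_cos_eq_zero {n : ℤ} {f ρ : ℝ → ℝ} (h : IsDirectionDatum n f ρ) :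
    ∃ p, Real.cos (f p) = 0 := by
  obtain ⟨p, q, c, hp, hq, hc⟩ := h.crossing
  obtain ⟨s, rfl⟩ := mem_range_of_exists_le_of_exists_ge h.contDiff_angle.continuous
    ⟨p, hp.le⟩ ⟨q, hq.le⟩
  exact ⟨s, hc⟩

theorem exists_cos_ne_zero {n : ℤ} {f ρ : ℝ → ℝ} (h : IsDirectionDatum n f ρ) :
    ∃ q, Real.cos (f q) ≠ 0 := by
  obtain ⟨p, q, c, hp, hq, hc⟩ := h.crossing
  have hlt : c < min (f q) (c + 1) := lt_min hq (by linarith)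
  obtain ⟨s, hs⟩ := mem_range_of_exists_le_of_exists_ge h.contDiff_angle.continuous
    ⟨p, (hp.trans hlt).le⟩ ⟨q, min_le_left (f q) (c + 1)⟩
  refine ⟨s, ?_⟩
  have hle : f s ≤ c + 1 := hs ▸ min_le_right _ _
  rw [← hs] at hlt
  have hsin : 0 < Real.sin (f s - c) :=
    Real.sin_pos_of_pos_of_lt_pi (by linarith) (by linarith [Real.pi_gt_three])
  rw [show f s = c + (f s - c) by ring, Real.cos_add, hc, zero_mul, zero_sub]
  exact neg_ne_zero.2 (mul_ne_zero (sin_ne_zero_of_cos_eq_zero hc) hsin.ne')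

theorem cos_add_one {n : ℤ} {f ρ : ℝ → ℝ} (h : IsDirectionDatum n f ρ) (s : ℝ) :
    Real.cos (f (s + 1)) = Real.cos (f s) := by
  rw [h.angle_add_one, mul_comm (2 * Real.pi), Real.cos_add_int_mul_two_pi]

theorem sin_add_one {n : ℤ} {f ρ : ℝ → ℝ} (h : IsDirectionDatum n f ρ) (s : ℝ) :
    Real.sin (f (s + 1)) = Real.sin (f s) := by
  rw [h.angle_add_one, mul_comm (2 * Real.pi), Real.sin_add_int_mul_two_pi]

theorem integral_cos_sq_pos {n : ℤ} {f ρ : ℝ → ℝ} (h : IsDirectionDatum n f ρ) :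
    0 < ∫ σ in (0:ℝ)..1, Real.cos (f σ) ^ 2 := by
  have := h.contDiff_angle.continuous
  obtain ⟨q, hq⟩ := h.exists_cos_ne_zero
  exact Function.Periodic.integral_pos (by fun_prop) (fun s => by rw [h.cos_add_one])
    (fun s => sq_nonneg _) (pow_ne_zero 2 hq)

theorem contDiff_uncurry_ordinateSpeed {n : ℤ} {F R : ℝ → ℝ → ℝ}
    (hF : ContDiff ℝ ∞ (Function.uncurry F)) (hR : ContDiff ℝ ∞ (Function.uncurry R))
    (h : ∀ t, IsDirectionDatum n (F t) (R t)) :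
    ContDiff ℝ ∞ (Function.uncurry fun t => ordinateSpeed (F t) (R t)) := by
  have h₁ : ContDiff ℝ ∞ (fun t => ∫ σ in (0:ℝ)..1, R t σ * Real.sin (F t σ)) :=
    contDiff_integral_zero_one (hR.mul hF.sin)
  have h₂ : ContDiff ℝ ∞ (fun t => ∫ σ in (0:ℝ)..1, Real.cos (F t σ) ^ 2) :=
    contDiff_integral_zero_one (hF.cos.pow 2)
  exact (hR.mul hF.sin).sub
    (((h₁.div h₂ fun t => (h t).integral_cos_sq_pos.ne').comp contDiff_fst).mul (hF.cos.pow 2))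

theorem continuous_ordinateSpeed {n : ℤ} {f ρ : ℝ → ℝ} (h : IsDirectionDatum n f ρ) :
    Continuous (ordinateSpeed f ρ) := by
  have := h.contDiff_angle.continuous
  have := h.contDiff_speed.continuous
  unfold ordinateSpeed
  fun_prop

theorem periodic_ordinateSpeed {n : ℤ} {f ρ : ℝ → ℝ} (h : IsDirectionDatum n f ρ) :
    Function.Periodic (ordinateSpeed f ρ) 1 := fun s => by
  simp only [ordinateSpeed, h.cos_add_one, h.sin_add_one, h.periodic_speed s]

theorem integral_ordinateSpeed {n : ℤ} {f ρ : ℝ → ℝ} (h : IsDirectionDatum n f ρ) :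
    ∫ s in (0:ℝ)..1, ordinateSpeed f ρ s = 0 := by
  have := h.contDiff_angle.continuous
  have := h.contDiff_speed.continuous
  have hI : ∀ {h : ℝ → ℝ}, Continuous h → IntervalIntegrable h volume 0 1 :=
    fun h => h.intervalIntegrable 0 1
  unfold ordinateSpeed
  rw [intervalIntegral.integral_sub (hI (by fun_prop)) (hI (by fun_prop)),
    intervalIntegral.integral_const_mul, div_mul_cancel₀ _ h.integral_cos_sq_pos.ne', sub_self]

theorem hasDerivAt_ordinate {n : ℤ} {f ρ : ℝ → ℝ} (h : IsDirectionDatum n f ρ) (y₀ s : ℝ) :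
    HasDerivAt (ordinate f ρ y₀) (ordinateSpeed f ρ s) s :=
  hasDerivAt_primitive h.continuous_ordinateSpeed y₀ s

theorem continuous_ordinate {n : ℤ} {f ρ : ℝ → ℝ} (h : IsDirectionDatum n f ρ) (y₀ : ℝ) :
    Continuous (ordinate f ρ y₀) :=
  continuous_iff_continuousAt.2 fun s => (h.hasDerivAt_ordinate y₀ s).continuousAt

theorem periodic_ordinate {n : ℤ} {f ρ : ℝ → ℝ} (h : IsDirectionDatum n f ρ) (y₀ : ℝ) :
    Function.Periodic (ordinate f ρ y₀) 1 :=
  h.periodic_ordinateSpeed.primitive h.continuous_ordinateSpeed h.integral_ordinateSpeed y₀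

theorem exists_ordinateSpeed_ne_zero {n : ℤ} {f ρ : ℝ → ℝ} (h : IsDirectionDatum n f ρ) :
    ∃ p, ordinateSpeed f ρ p ≠ 0 := by
  obtain ⟨p, hp⟩ := h.exists_cos_eq_zero
  exact ⟨p, by simpa [ordinateSpeed, hp] using
    ⟨(h.speed_pos p).ne', sin_ne_zero_of_cos_eq_zero hp⟩⟩

theorem integral_ordinateSpeed_sq_pos {n : ℤ} {f ρ : ℝ → ℝ} (h : IsDirectionDatum n f ρ) :
    0 < ∫ σ in (0:ℝ)..1, ordinateSpeed f ρ σ ^ 2 := by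
  obtain ⟨p, hp⟩ := h.exists_ordinateSpeed_ne_zero
  exact Function.Periodic.integral_pos (h.continuous_ordinateSpeed.pow 2)
    (fun s => by rw [h.periodic_ordinateSpeed s]) (fun s => sq_nonneg _) (pow_ne_zero 2 hp)

theorem integral_centered_sq_pos {n : ℤ} {f ρ : ℝ → ℝ} (h : IsDirectionDatum n f ρ)
    (y₀ b : ℝ) : 0 < ∫ σ in (0:ℝ)..1, ((ordinate f ρ y₀ σ - b) * ordinateSpeed f ρ σ) ^ 2 := by
  have hw := h.continuous_ordinateSpeed
  have hy := h.continuous_ordinate y₀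
  obtain ⟨q, hq⟩ : ∃ q, (ordinate f ρ y₀ q - b) * ordinateSpeed f ρ q ≠ 0 := by
    by_contra! hall
    obtain ⟨p, hp⟩ := h.exists_ordinateSpeed_ne_zero
    have hev : ordinate f ρ y₀ =ᶠ[nhds p] fun _ => b := by
      filter_upwards [hw.continuousAt.eventually_ne hp] with s hs
      exact sub_eq_zero.1 ((mul_eq_zero.1 (hall s)).resolve_right hs)
    exact hp ((h.hasDerivAt_ordinate y₀ p).unique
      ((hasDerivAt_const p b).congr_of_eventuallyEq hev))
  exact Function.Periodic.integral_pos ((hy.sub continuous_const).mul hw |>.pow 2)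
    (fun s => by simp only [h.periodic_ordinateSpeed s, h.periodic_ordinate y₀ s])
    (fun s => sq_nonneg _) (pow_ne_zero 2 hq)

theorem continuous_abscissaSpeed {n : ℤ} {f ρ : ℝ → ℝ} (h : IsDirectionDatum n f ρ) (y₀ : ℝ) :
    Continuous (abscissaSpeed f ρ y₀) := by
  have := h.contDiff_angle.continuous
  have := h.contDiff_speed.continuous
  have := h.continuous_ordinateSpeed
  have := h.continuous_ordinate y₀
  unfold abscissaSpeed orthogonalized
  fun_prop

theorem periodic_abscissaSpeed {n : ℤ} {f ρ : ℝ → ℝ} (h : IsDirectionDatum n f ρ) (y₀ : ℝ) :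
    Function.Periodic (abscissaSpeed f ρ y₀) 1 := fun s => by
  simp only [abscissaSpeed, orthogonalized, h.cos_add_one, h.periodic_speed s,
    h.periodic_ordinateSpeed s, h.periodic_ordinate y₀ s]

theorem integral_abscissaSpeed {n : ℤ} {f ρ : ℝ → ℝ} (h : IsDirectionDatum n f ρ) (y₀ : ℝ) :
    (∫ s in (0:ℝ)..1, abscissaSpeed f ρ y₀ s = 0) ∧
      ∫ s in (0:ℝ)..1, ordinate f ρ y₀ s * abscissaSpeed f ρ y₀ s = 0 :=
  integral_orthogonalized
    (h.contDiff_speed.continuous.mul (Real.continuous_cos.comp h.contDiff_angle.continuous))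
    h.continuous_ordinateSpeed (h.continuous_ordinate y₀) h.integral_ordinateSpeed_sq_pos.ne'
    (h.integral_centered_sq_pos y₀ _).ne'

theorem contDiff_uncurry_ordinate {n : ℤ} {F R : ℝ → ℝ → ℝ} {Y : ℝ → ℝ}
    (hF : ContDiff ℝ ∞ (Function.uncurry F)) (hR : ContDiff ℝ ∞ (Function.uncurry R))
    (hY : ContDiff ℝ ∞ Y) (h : ∀ t, IsDirectionDatum n (F t) (R t)) :
    ContDiff ℝ ∞ (Function.uncurry fun t => ordinate (F t) (R t) (Y t)) :=
  (hY.comp contDiff_fst).add (contDiff_primitive (contDiff_uncurry_ordinateSpeed hF hR h))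

theorem contDiff_uncurry_abscissaSpeed {n : ℤ} {F R : ℝ → ℝ → ℝ} {Y : ℝ → ℝ}
    (hF : ContDiff ℝ ∞ (Function.uncurry F)) (hR : ContDiff ℝ ∞ (Function.uncurry R))
    (hY : ContDiff ℝ ∞ Y) (h : ∀ t, IsDirectionDatum n (F t) (R t)) :
    ContDiff ℝ ∞ (Function.uncurry fun t => abscissaSpeed (F t) (R t) (Y t)) := by
  have hw := contDiff_uncurry_ordinateSpeed hF hR h
  have hy := contDiff_uncurry_ordinate hF hR hY h
  have hg : ContDiff ℝ ∞ (Function.uncurry fun t s => R t s * Real.cos (F t s)) := hR.mul hF.cos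
  have hA : ContDiff ℝ ∞ (fun t => ∫ σ in (0:ℝ)..1, ordinateSpeed (F t) (R t) σ ^ 2) :=
    contDiff_integral_zero_one (hw.pow 2)
  have hb : ContDiff ℝ ∞ (fun t => weightedMean (ordinateSpeed (F t) (R t))
      (ordinate (F t) (R t) (Y t))) :=
    (contDiff_integral_zero_one (hy.mul (hw.pow 2))).div hA
      fun t => (h t).integral_ordinateSpeed_sq_pos.ne'
  have hc : ContDiff ℝ ∞ (Function.uncurry fun t s => ordinate (F t) (R t) (Y t) s -
      weightedMean (ordinateSpeed (F t) (R t)) (ordinate (F t) (R t) (Y t))) :=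
    hy.sub (hb.comp contDiff_fst)
  have he₁ := (contDiff_integral_zero_one hg).div hA
    fun t => (h t).integral_ordinateSpeed_sq_pos.ne'
  have hcg : ContDiff ℝ ∞ (fun t => ∫ σ in (0:ℝ)..1, (ordinate (F t) (R t) (Y t) σ -
      weightedMean (ordinateSpeed (F t) (R t)) (ordinate (F t) (R t) (Y t))) *
        (R t σ * Real.cos (F t σ))) := contDiff_integral_zero_one (hc.mul hg)
  have hcw : ContDiff ℝ ∞ (fun t => ∫ σ in (0:ℝ)..1, ((ordinate (F t) (R t) (Y t) σ -
      weightedMean (ordinateSpeed (F t) (R t)) (ordinate (F t) (R t) (Y t))) *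
        ordinateSpeed (F t) (R t) σ) ^ 2) := contDiff_integral_zero_one ((hc.mul hw).pow 2)
  have he₂ := hcg.div hcw fun t => ((h t).integral_centered_sq_pos (Y t) _).ne'
  exact (hg.sub ((he₁.comp contDiff_fst).mul (hw.pow 2))).sub
    ((he₂.comp contDiff_fst).mul (hc.mul (hw.pow 2)))

theorem contDiff_uncurry_legLoop {n : ℤ} {F R : ℝ → ℝ → ℝ} {X Y Z : ℝ → ℝ}
    (hF : ContDiff ℝ ∞ (Function.uncurry F)) (hR : ContDiff ℝ ∞ (Function.uncurry R))
    (hX : ContDiff ℝ ∞ X) (hY : ContDiff ℝ ∞ Y) (hZ : ContDiff ℝ ∞ Z)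
    (h : ∀ t, IsDirectionDatum n (F t) (R t)) :
    ContDiff ℝ ∞ (Function.uncurry fun t => legLoop (F t) (R t) (X t) (Y t) (Z t)) := by
  have hu := contDiff_uncurry_abscissaSpeed hF hR hY h
  have hy := contDiff_uncurry_ordinate hF hR hY h
  have hz : ContDiff ℝ ∞ (Function.uncurry fun t s => ∫ σ in (0:ℝ)..s,
      ordinate (F t) (R t) (Y t) σ * abscissaSpeed (F t) (R t) (Y t) σ) :=
    contDiff_primitive (hy.mul hu)
  exact ((hX.comp contDiff_fst).add (contDiff_primitive hu)).prodMk
    (hy.prodMk ((hZ.comp contDiff_fst).add hz))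

theorem polar_ne_zero {n : ℤ} {f ρ : ℝ → ℝ} (h : IsDirectionDatum n f ρ) (c s : ℝ) :
    ρ s * Real.cos (f s) ≠ 0 ∨ ρ s * Real.sin (f s) - c * Real.cos (f s) ^ 2 ≠ 0 := by
  by_cases hc : Real.cos (f s) = 0
  · right
    simpa [hc] using ⟨(h.speed_pos s).ne', sin_ne_zero_of_cos_eq_zero hc⟩
  · exact Or.inl (mul_ne_zero (h.speed_pos s).ne' hc)

theorem velocity_ne_zero {n : ℤ} {f ρ : ℝ → ℝ} (h : IsDirectionDatum n f ρ) (y₀ s : ℝ) :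
    abscissaSpeed f ρ y₀ s ≠ 0 ∨ ordinateSpeed f ρ s ≠ 0 := by
  by_cases hw : ordinateSpeed f ρ s = 0
  · left
    have := (h.polar_ne_zero _ s).resolve_right (not_not.2 hw)
    simpa [abscissaSpeed, orthogonalized, hw] using this
  · exact Or.inr hw

theorem hasDerivAt_legLoop_fst {n : ℤ} {f ρ : ℝ → ℝ} (h : IsDirectionDatum n f ρ)
    (x₀ y₀ z₀ s : ℝ) :
    HasDerivAt (fun t => (legLoop f ρ x₀ y₀ z₀ t).1) (abscissaSpeed f ρ y₀ s) s :=
  hasDerivAt_primitive (h.continuous_abscissaSpeed y₀) x₀ s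

theorem isLegendrianLoop_legLoop {n : ℤ} {f ρ : ℝ → ℝ} (h : IsDirectionDatum n f ρ)
    (x₀ y₀ z₀ : ℝ) : IsLegendrianLoop (legLoop f ρ x₀ y₀ z₀) where
  smooth := (contDiff_uncurry_legLoop (F := fun _ => f) (R := fun _ => ρ) (X := fun _ => x₀)
    (Y := fun _ => y₀) (Z := fun _ => z₀) (h.contDiff_angle.comp contDiff_snd)
    (h.contDiff_speed.comp contDiff_snd) contDiff_const contDiff_const contDiff_const
    fun _ => h).comp (contDiff_const.prodMk contDiff_id : ContDiff ℝ ∞ fun s : ℝ => ((0:ℝ), s))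
  periodic := by
    have hu := h.continuous_abscissaSpeed y₀
    have hy := h.continuous_ordinate y₀
    have h₁ := (h.periodic_abscissaSpeed y₀).primitive hu (h.integral_abscissaSpeed y₀).1 x₀
    have h₂ := ((h.periodic_ordinate y₀).mul (h.periodic_abscissaSpeed y₀)).primitive
      (hy.mul hu) (h.integral_abscissaSpeed y₀).2 z₀
    exact fun s => Prod.ext (h₁ s) (Prod.ext (h.periodic_ordinate y₀ s) (h₂ s))
  immersed := fun s hs => by
    have hu := h.continuous_abscissaSpeed y₀
    have hd : HasDerivAt (legLoop f ρ x₀ y₀ z₀) (abscissaSpeed f ρ y₀ s, ordinateSpeed f ρ s,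
        ordinate f ρ y₀ s * abscissaSpeed f ρ y₀ s) s :=
      (hasDerivAt_primitive hu x₀ s).prodMk ((h.hasDerivAt_ordinate y₀ s).prodMk
        (hasDerivAt_primitive ((h.continuous_ordinate y₀).mul hu) z₀ s))
    rw [hd.deriv] at hs
    rcases h.velocity_ne_zero y₀ s with h' | h'
    · exact h' (congrArg Prod.fst hs)
    · exact h' (congrArg (fun v => v.2.1) hs)
  tangent := fun s => by
    rw [(h.hasDerivAt_legLoop_fst x₀ y₀ z₀ s).deriv]
    exact (hasDerivAt_primitive
      ((h.continuous_ordinate y₀).mul (h.continuous_abscissaSpeed y₀)) z₀ s).deriv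

theorem hasLegRotationNumber_legLoop {n : ℤ} {f ρ : ℝ → ℝ} (h : IsDirectionDatum n f ρ)
    (x₀ y₀ z₀ : ℝ) : HasLegRotationNumber (legLoop f ρ x₀ y₀ z₀) n := by
  have hf := h.contDiff_angle.continuous
  have hρ := h.contDiff_speed.continuous
  have hu := h.continuous_abscissaSpeed y₀
  have hw := h.continuous_ordinateSpeed
  have hcos := by simpa using h.cos_add_one 0
  have hsin := by simpa using h.sin_add_one 0
  have hρ1 := by simpa using h.periodic_speed 0
  have hw1 := by simpa using h.periodic_ordinateSpeed 0
  have hu1 := by simpa using h.periodic_abscissaSpeed y₀ 0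
  obtain ⟨θ₁, hθ₁, hang₁, hrot₁⟩ := IsAngle.exists_of_homotopy
    (U := fun p => ρ p.2 * Real.cos (f p.2))
    (W := fun p => ρ p.2 * Real.sin (f p.2) - p.1 * ((∫ σ in (0:ℝ)..1, ρ σ * Real.sin (f σ)) /
      (∫ σ in (0:ℝ)..1, Real.cos (f σ) ^ 2)) * Real.cos (f p.2) ^ 2)
    (by fun_prop) (by fun_prop) (fun p => h.polar_ne_zero _ p.2)
    (fun t => by simp only [hρ1, hcos]) (fun t => by simp only [hρ1, hcos, hsin]) hf
    (by simpa using isAngle_polar h.speed_pos f)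
  obtain ⟨θ₂, hθ₂, hang₂, hrot₂⟩ := IsAngle.exists_of_homotopy
    (U := fun p => (1 - p.1) * (ρ p.2 * Real.cos (f p.2)) + p.1 * abscissaSpeed f ρ y₀ p.2)
    (W := fun p => ordinateSpeed f ρ p.2)
    (by fun_prop) (by fun_prop) (fun p => by
      by_cases h0 : ordinateSpeed f ρ p.2 = 0
      · left
        have hne := (h.polar_ne_zero _ p.2).resolve_right (not_not.2 h0)
        have heq : abscissaSpeed f ρ y₀ p.2 = ρ p.2 * Real.cos (f p.2) := by
          simp [abscissaSpeed, orthogonalized, h0]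
        rw [heq]
        convert hne using 1
        ring
      · exact Or.inr h0)
    (fun t => by simp only [hρ1, hcos, hu1]) (fun t => by simp only [hw1]) hθ₁
    (by simpa [ordinateSpeed] using hang₁)
  refine ⟨θ₂, hθ₂, fun s => ?_, ?_⟩
  · have hy : deriv (fun t => (legLoop f ρ x₀ y₀ z₀ t).2.1) s = ordinateSpeed f ρ s :=
      (h.hasDerivAt_ordinate y₀ s).deriv
    rw [(h.hasDerivAt_legLoop_fst x₀ y₀ z₀ s).deriv, hy]
    simpa using hang₂ s
  · have := h.angle_add_one 0
    rw [zero_add] at this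
    rw [hrot₂, hrot₁, this]
    ring

end IsDirectionDatum

/-! ### Paths of direction data -/

theorem exists_cos_eq_zero_of_pi_lt {a b : ℝ} (h : a + Real.pi < b) :
    ∃ c, a < c ∧ c < b ∧ Real.cos c = 0 := by
  have hπ := Real.pi_pos
  refine ⟨(2 * (⌊(a - Real.pi / 2) / Real.pi⌋ + 1 : ℤ) + 1) * Real.pi / 2, ?_, ?_,
    Real.cos_eq_zero_iff.2 ⟨_, rfl⟩⟩
  · have := (div_lt_iff₀ hπ).1 (Int.lt_floor_add_one ((a - Real.pi / 2) / Real.pi))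
    push_cast
    linarith
  · have := (le_div_iff₀ hπ).1 (Int.floor_le ((a - Real.pi / 2) / Real.pi))
    push_cast
    linarith

theorem crossing_of_ne_zero {n : ℤ} (hn : n ≠ 0) {f : ℝ → ℝ}
    (hf : ∀ s, f (s + 1) = f s + 2 * Real.pi * n) :
    ∃ p q c, f p < c ∧ c < f q ∧ Real.cos c = 0 := by
  have hπ := Real.pi_pos
  have h01 := hf 0
  rw [zero_add] at h01
  rcases lt_or_gt_of_ne hn with hn | hn
  · have hn' : (n : ℝ) ≤ -1 := by exact_mod_cast Int.le_sub_one_of_lt hn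
    obtain ⟨c, h⟩ := exists_cos_eq_zero_of_pi_lt (a := f 1) (b := f 0) (by nlinarith)
    exact ⟨1, 0, c, h⟩
  · have hn' : (1 : ℝ) ≤ n := by exact_mod_cast hn
    obtain ⟨c, h⟩ := exists_cos_eq_zero_of_pi_lt (a := f 0) (b := f 1) (by nlinarith)
    exact ⟨0, 1, c, h⟩

theorem crossing_const_add_sin (c m : ℝ) :
    ∃ p q c', c + 4 * Real.sin (2 * Real.pi * (p - m)) < c' ∧
      c' < c + 4 * Real.sin (2 * Real.pi * (q - m)) ∧ Real.cos c' = 0 := by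
  refine ⟨m - 1 / 4, m + 1 / 4, ?_⟩
  rw [show 2 * Real.pi * (m - 1 / 4 - m) = -(Real.pi / 2) by ring,
    show 2 * Real.pi * (m + 1 / 4 - m) = Real.pi / 2 by ring, Real.sin_neg, Real.sin_pi_div_two]
  exact exists_cos_eq_zero_of_pi_lt (by linarith [Real.pi_lt_four])

theorem two_pi_mul_sin_add_one (s m : ℝ) :
    Real.sin (2 * Real.pi * (s + 1 - m)) = Real.sin (2 * Real.pi * (s - m)) := by
  rw [show 2 * Real.pi * (s + 1 - m) = 2 * Real.pi * (s - m) + 2 * Real.pi by ring,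
    Real.sin_add_two_pi]

/-- A periodic angle crossing `c` can be pushed linearly onto a large sine wave centred at `c`
while crossing `c` all the time. -/
theorem exists_phase {f : ℝ → ℝ} (hf : Function.Periodic f 1) {p q c : ℝ} (hp : f p < c)
    (hq : c < f q) : ∃ m q', ∀ a ∈ Set.Icc (0:ℝ) 1,
      (1 - a) * f p + a * (c + 4 * Real.sin (2 * Real.pi * (p - m))) < c ∧
      c < (1 - a) * f q' + a * (c + 4 * Real.sin (2 * Real.pi * (q' - m))) := by
  have hq' : f (p + Int.fract (q - p)) = f q := by
    rw [← hf.int_mul ⌊q - p⌋ (p + Int.fract (q - p)), ← Int.self_sub_floor]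
    congr 1
    ring
  set d := Int.fract (q - p) with hd
  have hd0 : 0 < d := by
    refine lt_of_le_of_ne (Int.fract_nonneg _) fun h0 => ?_
    rw [← h0, add_zero] at hq'
    linarith
  have hd1 : d < 1 := Int.fract_lt_one _
  have hsin : 0 < Real.sin (Real.pi * d) :=
    Real.sin_pos_of_pos_of_lt_pi (by positivity) (by nlinarith [Real.pi_pos])
  refine ⟨p + d / 2, p + d, fun a ha => ?_⟩
  rw [show 2 * Real.pi * (p - (p + d / 2)) = -(Real.pi * d) by ring,
    show 2 * Real.pi * (p + d - (p + d / 2)) = Real.pi * d by ring, Real.sin_neg, hq']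
  obtain ⟨h0, h1⟩ := ha
  constructor
  · rcases h0.eq_or_lt with rfl | h0
    · linarith
    · nlinarith [mul_pos h0 hsin, mul_nonneg (sub_nonneg.2 h1) (sub_nonneg.2 hp.le)]
  · rcases h0.eq_or_lt with rfl | h0
    · linarith
    · nlinarith [mul_pos h0 hsin, mul_nonneg (sub_nonneg.2 h1) (sub_nonneg.2 hq.le)]

theorem exists_angle_path_of_periodic {f₀ f₁ : ℝ → ℝ} (hf₀ : ContDiff ℝ ∞ f₀)
    (hf₁ : ContDiff ℝ ∞ f₁) (hper₀ : Function.Periodic f₀ 1) (hper₁ : Function.Periodic f₁ 1)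
    (hc₀ : ∃ p q c, f₀ p < c ∧ c < f₀ q ∧ Real.cos c = 0)
    (hc₁ : ∃ p q c, f₁ p < c ∧ c < f₁ q ∧ Real.cos c = 0) :
    ∃ F : ℝ → ℝ → ℝ, ContDiff ℝ ∞ (Function.uncurry F) ∧ (∀ t, Function.Periodic (F t) 1) ∧
      (∀ t, ∃ p q c, F t p < c ∧ c < F t q ∧ Real.cos c = 0) ∧ F 0 = f₀ ∧ F 1 = f₁ := by
  obtain ⟨p₀, q₀, c₀, hp₀, hq₀, hcos₀⟩ := hc₀
  obtain ⟨p₁, q₁, c₁, hp₁, hq₁, hcos₁⟩ := hc₁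
  obtain ⟨m₀, q₀', hm₀⟩ := exists_phase hper₀ hp₀ hq₀
  obtain ⟨m₁, q₁', hm₁⟩ := exists_phase hper₁ hp₁ hq₁
  let a : ℝ → ℝ := fun t => Real.smoothTransition (3 * t)
  let b : ℝ → ℝ := fun t => Real.smoothTransition (3 * t - 1)
  let d : ℝ → ℝ := fun t => Real.smoothTransition (3 * t - 2)
  have ha : ContDiff ℝ ∞ a := Real.smoothTransition.contDiff.comp (by fun_prop)
  have hb : ContDiff ℝ ∞ b := Real.smoothTransition.contDiff.comp (by fun_prop)
  have hd : ContDiff ℝ ∞ d := Real.smoothTransition.contDiff.comp (by fun_prop)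
  refine ⟨fun t s => (1 - a t) * f₀ s + (a t - d t) * ((1 - b t) * c₀ + b t * c₁ +
    4 * Real.sin (2 * Real.pi * (s - ((1 - b t) * m₀ + b t * m₁)))) + d t * f₁ s,
    ?_, ?_, ?_, ?_, ?_⟩
  · unfold Function.uncurry
    fun_prop
  · intro t s
    simp only [hper₀ s, hper₁ s, two_pi_mul_sin_add_one]
  · intro t
    have hmem : ∀ x, Real.smoothTransition x ∈ Set.Icc (0:ℝ) 1 := fun x =>
      ⟨Real.smoothTransition.nonneg x, Real.smoothTransition.le_one x⟩
    rcases le_total t (1 / 3) with h₁ | h₁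
    · have hb0 : b t = 0 := Real.smoothTransition.zero_of_nonpos (by linarith)
      have hd0 : d t = 0 := Real.smoothTransition.zero_of_nonpos (by linarith)
      refine ⟨p₀, q₀', c₀, ?_, ?_, hcos₀⟩
      · simpa [hb0, hd0] using (hm₀ (a t) (hmem _)).1
      · simpa [hb0, hd0] using (hm₀ (a t) (hmem _)).2
    have ha1 : a t = 1 := Real.smoothTransition.one_of_one_le (by linarith)
    rcases le_total t (2 / 3) with h₂ | h₂
    · have hd0 : d t = 0 := Real.smoothTransition.zero_of_nonpos (by linarith)
      simpa [ha1, hd0] using crossing_const_add_sin ((1 - b t) * c₀ + b t * c₁)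
        ((1 - b t) * m₀ + b t * m₁)
    · have hb1 : b t = 1 := Real.smoothTransition.one_of_one_le (by linarith)
      have hd' : 1 - d t ∈ Set.Icc (0:ℝ) 1 :=
        ⟨sub_nonneg.2 (hmem _).2, sub_le_self _ (hmem _).1⟩
      refine ⟨p₁, q₁', c₁, ?_, ?_, hcos₁⟩
      · simpa [hb1, ha1, add_comm] using (hm₁ (1 - d t) hd').1
      · simpa [hb1, ha1, add_comm] using (hm₁ (1 - d t) hd').2
  · have ha0 : a 0 = 0 := Real.smoothTransition.zero_of_nonpos (by norm_num)
    have hd0 : d 0 = 0 := Real.smoothTransition.zero_of_nonpos (by norm_num)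
    ext s
    simp [ha0, hd0]
  · have ha1 : a 1 = 1 := Real.smoothTransition.one_of_one_le (by norm_num)
    have hd1 : d 1 = 1 := Real.smoothTransition.one_of_one_le (by norm_num)
    ext s
    simp [ha1, hd1]

/-- The convex combination of `a` and `b` whose weight moves smoothly from `a` at `t = 0` to `b`
at `t = 1`. -/
noncomputable def smoothMix (a b t : ℝ) : ℝ :=
  (1 - Real.smoothTransition t) * a + Real.smoothTransition t * b

@[simp] theorem smoothMix_zero (a b : ℝ) : smoothMix a b 0 = a := by simp [smoothMix]

@[simp] theorem smoothMix_one (a b : ℝ) : smoothMix a b 1 = b := by simp [smoothMix]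

theorem contDiff_smoothMix (a b : ℝ) : ContDiff ℝ ∞ (smoothMix a b) := by
  have := Real.smoothTransition.contDiff (n := ⊤)
  unfold smoothMix
  fun_prop

theorem contDiff_uncurry_smoothMix {f g : ℝ → ℝ} (hf : ContDiff ℝ ∞ f) (hg : ContDiff ℝ ∞ g) :
    ContDiff ℝ ∞ (Function.uncurry fun t s => smoothMix (f s) (g s) t) := by
  have := Real.smoothTransition.contDiff (n := ⊤)
  unfold smoothMix Function.uncurry
  fun_prop

theorem smoothMix_pos {a b : ℝ} (ha : 0 < a) (hb : 0 < b) (t : ℝ) : 0 < smoothMix a b t := by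
  have h0 := Real.smoothTransition.nonneg t
  have h1 := Real.smoothTransition.le_one t
  unfold smoothMix
  rcases h0.eq_or_lt with h | h
  · rw [← h]; simpa using ha
  · exact add_pos_of_nonneg_of_pos (mul_nonneg (by linarith) ha.le) (mul_pos h hb)

theorem IsDirectionDatum.exists_path {n : ℤ} {f₀ ρ₀ f₁ ρ₁ : ℝ → ℝ}
    (h₀ : IsDirectionDatum n f₀ ρ₀) (h₁ : IsDirectionDatum n f₁ ρ₁) :
    ∃ F R : ℝ → ℝ → ℝ, ContDiff ℝ ∞ (Function.uncurry F) ∧ ContDiff ℝ ∞ (Function.uncurry R) ∧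
      (∀ t, IsDirectionDatum n (F t) (R t)) ∧ F 0 = f₀ ∧ F 1 = f₁ ∧ R 0 = ρ₀ ∧ R 1 = ρ₁ := by
  obtain ⟨F, hF, hFper, hFc, hF0, hF1⟩ : ∃ F : ℝ → ℝ → ℝ, ContDiff ℝ ∞ (Function.uncurry F) ∧
      (∀ t s, F t (s + 1) = F t s + 2 * Real.pi * n) ∧
      (∀ t, ∃ p q c, F t p < c ∧ c < F t q ∧ Real.cos c = 0) ∧ F 0 = f₀ ∧ F 1 = f₁ := by
    rcases eq_or_ne n 0 with rfl | hn
    · obtain ⟨F, hF, hper, hc, hF0, hF1⟩ := exists_angle_path_of_periodic h₀.contDiff_angle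
        h₁.contDiff_angle (fun s => by simpa using h₀.angle_add_one s)
        (fun s => by simpa using h₁.angle_add_one s) h₀.crossing h₁.crossing
      exact ⟨F, hF, fun t s => by simpa using hper t s, hc, hF0, hF1⟩
    · have hper : ∀ t s, smoothMix (f₀ (s + 1)) (f₁ (s + 1)) t
          = smoothMix (f₀ s) (f₁ s) t + 2 * Real.pi * n := fun t s => by
        rw [h₀.angle_add_one, h₁.angle_add_one, smoothMix, smoothMix]
        ring
      exact ⟨fun t s => smoothMix (f₀ s) (f₁ s) t,
        contDiff_uncurry_smoothMix h₀.contDiff_angle h₁.contDiff_angle, hper,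
        fun t => crossing_of_ne_zero hn (hper t), by simp, by simp⟩
  have hR := contDiff_uncurry_smoothMix h₀.contDiff_speed h₁.contDiff_speed
  have hslice : ∀ t : ℝ, ContDiff ℝ ∞ fun s : ℝ => (t, s) := fun t =>
    contDiff_const.prodMk contDiff_id
  exact ⟨F, fun t s => smoothMix (ρ₀ s) (ρ₁ s) t, hF, hR, fun t =>
    { contDiff_angle := hF.comp (hslice t)
      contDiff_speed := hR.comp (hslice t)
      angle_add_one := hFper t
      periodic_speed := fun s => by simp only [h₀.periodic_speed s, h₁.periodic_speed s]
      speed_pos := fun s => smoothMix_pos (h₀.speed_pos s) (h₁.speed_pos s) t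
      crossing := hFc t }, hF0, hF1, by simp, by simp⟩

/-! ### Direction data of a Legendrian loop -/

namespace IsLegendrianLoop

theorem contDiff_fst {γ : ℝ → ℝ × ℝ × ℝ} (h : IsLegendrianLoop γ) :
    ContDiff ℝ ∞ fun t => (γ t).1 := h.smooth.fst

theorem contDiff_snd_fst {γ : ℝ → ℝ × ℝ × ℝ} (h : IsLegendrianLoop γ) :
    ContDiff ℝ ∞ fun t => (γ t).2.1 := h.smooth.snd.fst

theorem contDiff_snd_snd {γ : ℝ → ℝ × ℝ × ℝ} (h : IsLegendrianLoop γ) :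
    ContDiff ℝ ∞ fun t => (γ t).2.2 := h.smooth.snd.snd

theorem velocity_ne_zero {γ : ℝ → ℝ × ℝ × ℝ} (h : IsLegendrianLoop γ) (s : ℝ) :
    deriv (fun t => (γ t).1) s ≠ 0 ∨ deriv (fun t => (γ t).2.1) s ≠ 0 := by
  by_contra! h0
  have hx := (h.contDiff_fst.differentiable (by simp) s).hasDerivAt
  have hy := (h.contDiff_snd_fst.differentiable (by simp) s).hasDerivAt
  have hz := (h.contDiff_snd_snd.differentiable (by simp) s).hasDerivAt
  rw [h.tangent, h0.1, mul_zero] at hz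
  rw [h0.1] at hx
  rw [h0.2] at hy
  exact h.immersed s (hx.prodMk (hy.prodMk hz)).deriv

theorem _root_.Function.Periodic.deriv_one {f : ℝ → ℝ} (hf : Function.Periodic f 1) :
    Function.Periodic (deriv f) 1 := fun s => by
  rw [← deriv_comp_add_const, funext hf]

theorem _root_.Function.Periodic.integral_deriv_eq_zero {f : ℝ → ℝ} (hf : ContDiff ℝ ∞ f)
    (hper : Function.Periodic f 1) : ∫ s in (0:ℝ)..1, deriv f s = 0 := by
  rw [intervalIntegral.integral_deriv_eq_sub (fun s _ => hf.differentiable (by simp) s)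
    ((hf.continuous_deriv (by simp)).intervalIntegrable 0 1)]
  simpa [sub_eq_zero] using hper 0

theorem periodic_fst {γ : ℝ → ℝ × ℝ × ℝ} (h : IsLegendrianLoop γ) :
    Function.Periodic (fun t => (γ t).1) 1 := fun s => by simp only [h.periodic s]

theorem periodic_snd_fst {γ : ℝ → ℝ × ℝ × ℝ} (h : IsLegendrianLoop γ) :
    Function.Periodic (fun t => (γ t).2.1) 1 := fun s => by simp only [h.periodic s]

theorem periodic_snd_snd {γ : ℝ → ℝ × ℝ × ℝ} (h : IsLegendrianLoop γ) :
    Function.Periodic (fun t => (γ t).2.2) 1 := fun s => by simp only [h.periodic s]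

theorem exists_deriv_fst_neg_pos {γ : ℝ → ℝ × ℝ × ℝ} (h : IsLegendrianLoop γ) :
    ∃ p q, deriv (fun t => (γ t).1) p < 0 ∧ 0 < deriv (fun t => (γ t).1) q := by
  have hcont := h.contDiff_fst.continuous_deriv (by simp)
  have hint := h.periodic_fst.integral_deriv_eq_zero h.contDiff_fst
  have hper := h.periodic_fst.deriv_one
  obtain ⟨c, -, hc⟩ := exists_deriv_eq_zero (f := fun t => (γ t).2.1) zero_lt_one
    h.contDiff_snd_fst.continuous.continuousOn (by simpa using (h.periodic_snd_fst 0).symm)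
  have hne := (h.velocity_ne_zero c).resolve_right (not_not.2 hc)
  have hneg : ∃ p, deriv (fun t => (γ t).1) p < 0 := by
    by_contra! hall
    exact (hper.integral_pos hcont hall hne).ne' hint
  have hpos : ∃ q, 0 < deriv (fun t => (γ t).1) q := by
    by_contra! hall
    have := Function.Periodic.integral_pos (g := fun s => -deriv (fun t => (γ t).1) s) hcont.neg
      (fun s => by simp only [hper s]) (fun s => neg_nonneg.2 (hall s)) (neg_ne_zero.2 hne)
    rw [intervalIntegral.integral_neg, hint, neg_zero] at this
    exact this.false
  exact ⟨_, _, hneg.choose_spec, hpos.choose_spec⟩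

/-- The speed of the Lagrangian projection `(x, y)` of a curve. -/
noncomputable def _root_.planarSpeed (γ : ℝ → ℝ × ℝ × ℝ) (s : ℝ) : ℝ :=
  Real.sqrt ((deriv (fun t => (γ t).1) s) ^ 2 + (deriv (fun t => (γ t).2.1) s) ^ 2)

theorem isDirectionDatum {γ : ℝ → ℝ × ℝ × ℝ} (h : IsLegendrianLoop γ) {n : ℤ} {θ : ℝ → ℝ}
    (hθ : Continuous θ)
    (hang : IsAngle (deriv fun t => (γ t).1) (deriv fun t => (γ t).2.1) θ)
    (hrot : θ 1 - θ 0 = 2 * Real.pi * n) : IsDirectionDatum n θ (planarSpeed γ) := by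
  have hx := (contDiff_infty_iff_deriv.1 h.contDiff_fst).2
  have hy := (contDiff_infty_iff_deriv.1 h.contDiff_snd_fst).2
  have hpos : ∀ s, 0 < planarSpeed γ s := fun s => speed_pos (h.velocity_ne_zero s)
  have hper : Function.Periodic (planarSpeed γ) 1 := fun s => by
    simp only [planarSpeed, h.periodic_fst.deriv_one s, h.periodic_snd_fst.deriv_one s]
  refine ⟨hang.contDiff hx hy h.velocity_ne_zero hθ,
    ((hx.pow 2).add (hy.pow 2)).sqrt fun s => (Real.sqrt_pos.1 (hpos s)).ne', fun s => ?_, hper,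
    hpos, ?_⟩
  · have hshift : IsAngle (deriv fun t => (γ t).1) (deriv fun t => (γ t).2.1)
        (fun s => θ (s + 1)) := fun s => by
      have := hang (s + 1)
      rwa [h.periodic_fst.deriv_one s, h.periodic_snd_fst.deriv_one s] at this
    have := hang.sub_eq h.velocity_ne_zero hθ (by fun_prop) hshift 0 s
    rw [zero_add] at this
    linarith
  · obtain ⟨p, q, hp, hq⟩ := h.exists_deriv_fst_neg_pos
    rw [(hang p).1] at hp
    rw [(hang q).1] at hq
    have hp' : Real.cos (θ p) < 0 := neg_of_mul_neg_right hp (hpos p).le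
    have hq' : 0 < Real.cos (θ q) := pos_of_mul_pos_right hq (hpos q).le
    rcases lt_trichotomy (θ p) (θ q) with hlt | heq | hlt
    · obtain ⟨c, hc, hc0⟩ := intermediate_value_Ioo hlt.le Real.continuous_cos.continuousOn
        ⟨hp', hq'⟩
      exact ⟨p, q, c, hc.1, hc.2, hc0⟩
    · rw [heq] at hp'
      exact absurd hp' hq'.le.not_gt
    · obtain ⟨c, hc, hc0⟩ := intermediate_value_Ioo' hlt.le Real.continuous_cos.continuousOn
        ⟨hp', hq'⟩
      exact ⟨q, p, c, hc.1, hc.2, hc0⟩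

theorem _root_.add_integral_deriv {f : ℝ → ℝ} (hf : ContDiff ℝ ∞ f) (s : ℝ) :
    f 0 + ∫ σ in (0:ℝ)..s, deriv f σ = f s := by
  rw [intervalIntegral.integral_deriv_eq_sub (fun s _ => hf.differentiable (by simp) s)
    ((hf.continuous_deriv (by simp)).intervalIntegrable 0 s)]
  ring

theorem legLoop_eq {γ : ℝ → ℝ × ℝ × ℝ} (h : IsLegendrianLoop γ) {θ : ℝ → ℝ}
    (hang : IsAngle (deriv fun t => (γ t).1) (deriv fun t => (γ t).2.1) θ) :
    legLoop θ (planarSpeed γ) (γ 0).1 (γ 0).2.1 (γ 0).2.2 = γ := by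
  have hcos : ∀ s, planarSpeed γ s * Real.cos (θ s) = deriv (fun t => (γ t).1) s :=
    fun s => (hang s).1.symm
  have hsin : ∀ s, planarSpeed γ s * Real.sin (θ s) = deriv (fun t => (γ t).2.1) s :=
    fun s => (hang s).2.symm
  have hx0 := h.periodic_fst.integral_deriv_eq_zero h.contDiff_fst
  have hw : ordinateSpeed θ (planarSpeed γ) = deriv fun t => (γ t).2.1 := by
    ext s
    simp only [ordinateSpeed, hsin,
      h.periodic_snd_fst.integral_deriv_eq_zero h.contDiff_snd_fst, zero_div, zero_mul, sub_zero]
  have hy : ordinate θ (planarSpeed γ) (γ 0).2.1 = fun t => (γ t).2.1 := by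
    ext s
    simp only [ordinate, hw]
    exact add_integral_deriv h.contDiff_snd_fst s
  have hmom : ∀ b : ℝ, ∫ σ in (0:ℝ)..1, ((γ σ).2.1 - b) * deriv (fun t => (γ t).1) σ = 0 := by
    intro b
    have hz := h.periodic_snd_snd.integral_deriv_eq_zero h.contDiff_snd_snd
    have hzI := (h.contDiff_snd_snd.continuous_deriv (by simp)).intervalIntegrable
      (μ := volume) 0 1
    have hxI := ((h.contDiff_fst.continuous_deriv (by simp)).const_mul b).intervalIntegrable
      (μ := volume) 0 1
    simp only [sub_mul, ← h.tangent]
    rw [intervalIntegral.integral_sub hzI hxI, hz, intervalIntegral.integral_const_mul, hx0]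
    ring
  have hu : abscissaSpeed θ (planarSpeed γ) (γ 0).2.1 = deriv fun t => (γ t).1 := by
    ext s
    simp only [abscissaSpeed, orthogonalized, hcos, hw, hy, hx0, hmom, zero_div, zero_mul,
      sub_zero]
  ext s : 1
  refine Prod.ext ?_ (Prod.ext ?_ ?_)
  · simp only [legLoop, hu]
    exact add_integral_deriv h.contDiff_fst s
  · simp only [legLoop, hy]
  · simp only [legLoop, hu, hy, ← h.tangent]
    exact add_integral_deriv h.contDiff_snd_snd s

end IsLegendrianLoop

/-! ### Regular homotopies -/

theorem exists_legendrianRegularHomotopy {γ₀ γ₁ : ℝ → ℝ × ℝ × ℝ} {n : ℤ}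
    (h₀ : IsLegendrianLoop γ₀) (h₁ : IsLegendrianLoop γ₁) (hr₀ : HasLegRotationNumber γ₀ n)
    (hr₁ : HasLegRotationNumber γ₁ n) :
    ∃ H : ℝ → ℝ → ℝ × ℝ × ℝ, IsLegendrianRegularHomotopy H ∧ H 0 = γ₀ ∧ H 1 = γ₁ := by
  obtain ⟨θ₀, hθ₀, hang₀, hrot₀⟩ := hr₀
  obtain ⟨θ₁, hθ₁, hang₁, hrot₁⟩ := hr₁
  obtain ⟨F, R, hF, hR, h, hF0, hF1, hR0, hR1⟩ :=
    (h₀.isDirectionDatum hθ₀ hang₀ hrot₀).exists_path (h₁.isDirectionDatum hθ₁ hang₁ hrot₁)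
  refine ⟨fun t => legLoop (F t) (R t) (smoothMix (γ₀ 0).1 (γ₁ 0).1 t)
    (smoothMix (γ₀ 0).2.1 (γ₁ 0).2.1 t) (smoothMix (γ₀ 0).2.2 (γ₁ 0).2.2 t),
    ⟨(IsDirectionDatum.contDiff_uncurry_legLoop hF hR (contDiff_smoothMix _ _)
      (contDiff_smoothMix _ _) (contDiff_smoothMix _ _) h).contDiffOn,
      fun t _ => (h t).isLegendrianLoop_legLoop _ _ _⟩, ?_, ?_⟩
  · simpa [hF0, hR0] using h₀.legLoop_eq hang₀
  · simpa [hF1, hR1] using h₁.legLoop_eq hang₁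

/-- The partial derivative in the second variable of a map which is smooth on a strip is
continuous on the strip. -/
theorem continuousOn_deriv_of_contDiffOn_strip {H : ℝ → ℝ → ℝ × ℝ × ℝ}
    (hH : ContDiffOn ℝ ∞ (Function.uncurry H) (Set.Icc (0:ℝ) 1 ×ˢ (Set.univ : Set ℝ))) :
    ContinuousOn (fun q : ℝ × ℝ => deriv (H q.1) q.2)
      (Set.Icc (0:ℝ) 1 ×ˢ (Set.univ : Set ℝ)) := by
  have huniq : UniqueDiffOn ℝ (Set.Icc (0:ℝ) 1 ×ˢ (Set.univ : Set ℝ)) :=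
    (uniqueDiffOn_Icc zero_lt_one).prod uniqueDiffOn_univ
  have hcont := hH.continuousOn_fderivWithin huniq (by simp)
  refine (hcont.clm_apply (continuousOn_const (c := ((0:ℝ), (1:ℝ))))).congr ?_
  rintro ⟨t, s⟩ hq
  have hd := (hH.differentiableOn (by simp) (t, s) hq).hasFDerivWithinAt
  have hline : HasDerivWithinAt (fun s : ℝ => (t, s)) ((0:ℝ), (1:ℝ)) Set.univ s :=
    ((hasDerivAt_const s t).prodMk (hasDerivAt_id s)).hasDerivWithinAt
  have := hd.comp_hasDerivWithinAt s hline (fun s' _ => ⟨hq.1, Set.mem_univ s'⟩)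
  exact (hasDerivWithinAt_univ.1 this).deriv

theorem rotationNumber_eq_of_homotopy {H : ℝ → ℝ → ℝ × ℝ × ℝ}
    (hH : IsLegendrianRegularHomotopy H) {n₀ n₁ : ℤ} (hr₀ : HasLegRotationNumber (H 0) n₀)
    (hr₁ : HasLegRotationNumber (H 1) n₁) : n₀ = n₁ := by
  obtain ⟨hsmooth, hloop⟩ := hH
  obtain ⟨θ₀, hθ₀, hang₀, hrot₀⟩ := hr₀
  obtain ⟨θ₁, hθ₁, hang₁, hrot₁⟩ := hr₁
  let π : ℝ → ℝ := fun t => Set.projIcc (0:ℝ) 1 zero_le_one t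
  have hπmem : ∀ t, π t ∈ Set.Icc (0:ℝ) 1 := fun t => (Set.projIcc (0:ℝ) 1 zero_le_one t).2
  have hπ0 : π 0 = 0 := by simp [π]
  have hπ1 : π 1 = 1 := by simp [π]
  have hπ : Continuous π := continuous_subtype_val.comp continuous_projIcc
  have hcont : Continuous fun q : ℝ × ℝ => deriv (H (π q.1)) q.2 :=
    (continuousOn_deriv_of_contDiffOn_strip hsmooth).comp_continuous
      (f := fun q : ℝ × ℝ => (π q.1, q.2)) (by fun_prop) fun q => ⟨hπmem _, Set.mem_univ _⟩
  have hderiv : ∀ t s, HasDerivAt (H (π t)) (deriv (H (π t)) s) s := fun t s =>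
    ((hloop _ (hπmem t)).smooth.differentiable (by simp) s).hasDerivAt
  have hx : ∀ t s, deriv (fun r => (H (π t) r).1) s = (deriv (H (π t)) s).1 := fun t s =>
    ((ContinuousLinearMap.fst ℝ ℝ (ℝ × ℝ)).hasFDerivAt.comp_hasDerivAt s (hderiv t s)).deriv
  have hy : ∀ t s, deriv (fun r => (H (π t) r).2.1) s = (deriv (H (π t)) s).2.1 := fun t s =>
    (((ContinuousLinearMap.fst ℝ ℝ ℝ).comp
      (ContinuousLinearMap.snd ℝ ℝ (ℝ × ℝ))).hasFDerivAt.comp_hasDerivAt s (hderiv t s)).deriv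
  obtain ⟨θ, hθ, hang, hrot⟩ := IsAngle.exists_of_homotopy
    (U := fun q => deriv (fun r => (H (π q.1) r).1) q.2)
    (W := fun q => deriv (fun r => (H (π q.1) r).2.1) q.2)
    (by simpa only [hx] using hcont.fst) (by simpa only [hy] using hcont.snd.fst)
    (fun q => (hloop _ (hπmem q.1)).velocity_ne_zero q.2)
    (fun t => by simpa using (hloop _ (hπmem t)).periodic_fst.deriv_one 0)
    (fun t => by simpa using (hloop _ (hπmem t)).periodic_snd_fst.deriv_one 0) hθ₀
    (by simp only [hπ0]; exact hang₀)
  simp only [hπ1] at hang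
  have hmem : (1:ℝ) ∈ Set.Icc (0:ℝ) 1 := by simp
  have h1 := IsAngle.sub_eq (hloop 1 hmem).velocity_ne_zero hθ hθ₁ hang hang₁ 0 1
  have h2 : 2 * Real.pi * (n₀ : ℝ) = 2 * Real.pi * n₁ := by rw [← hrot₀, ← hrot₁, ← h1, hrot]
  exact_mod_cast mul_left_cancel₀ Real.two_pi_pos.ne' h2

theorem exists_isDirectionDatum (n : ℤ) : ∃ f ρ : ℝ → ℝ, IsDirectionDatum n f ρ := by
  refine ⟨fun s => 2 * Real.pi * n * s + if n = 0 then 0 + 4 * Real.sin (2 * Real.pi * (s - 0))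
    else 0, fun _ => 1, ?_, contDiff_const, fun s => ?_, fun s => rfl, fun s => one_pos, ?_⟩
  · split_ifs <;> fun_prop
  · simp only [two_pi_mul_sin_add_one]
    ring
  · rcases eq_or_ne n 0 with rfl | hn
    · simpa using crossing_const_add_sin 0 0
    · exact crossing_of_ne_zero hn fun s => by
        simp only [if_neg hn]
        ring

/-- Every integer is realised as the rotation number of a Legendrian immersed
loop in `(ℝ³, ξ)`; consequently `rot` induces a one-to-one correspondence
between Legendrian regular homotopy classes of Legendrian immersed loops
and `ℤ`. -/
theorem legRot_bijection :
    (∀ n : ℤ, ∃ γ : ℝ → ℝ × ℝ × ℝ,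
      IsLegendrianLoop γ ∧ HasLegRotationNumber γ n) ∧
    (∀ (γ₀ γ₁ : ℝ → ℝ × ℝ × ℝ) (n₀ n₁ : ℤ),
      IsLegendrianLoop γ₀ → IsLegendrianLoop γ₁ →
      HasLegRotationNumber γ₀ n₀ → HasLegRotationNumber γ₁ n₁ →
      ((∃ H : ℝ → ℝ → ℝ × ℝ × ℝ,
          IsLegendrianRegularHomotopy H ∧ H 0 = γ₀ ∧ H 1 = γ₁) ↔ n₀ = n₁)) := by
  refine ⟨fun n => ?_, fun γ₀ γ₁ n₀ n₁ h₀ h₁ hr₀ hr₁ => ⟨?_, ?_⟩⟩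
  · obtain ⟨f, ρ, h⟩ := exists_isDirectionDatum n
    exact ⟨legLoop f ρ 0 0 0, h.isLegendrianLoop_legLoop 0 0 0,
      h.hasLegRotationNumber_legLoop 0 0 0⟩
  · rintro ⟨H, hH, rfl, rfl⟩
    exact rotationNumber_eq_of_homotopy hH hr₀ hr₁
  · rintro rfl
    exact exists_legendrianRegularHomotopy h₀ h₁ hr₀ hr₁
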